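/- Let A, B, C, D ∈ M₂(ℂ) and let T : F → M₂(F) be the unique ℂ-algebra homomorphism with T(x) = L(A,B) and T(y) = L(C,D). Then T maps the Grassmann ideal I into M₂(I) (i.e. every entry of T(f) lies in I for every f ∈ I) if and only if A·B = B·A, C·D = D·C, and A·D − D·A = B·C − C·B. -/

import Mathlib

noncomputable section

/-- The free associative `ℂ`-algebra on two generators. -/
abbrev F2 : Type := FreeAlgebra ℂ (Fin 2)

/-- The generator `x`. -/
def xg : F2 := FreeAlgebra.ι ℂ 0

/-- The generator `y`. -/
def yg : F2 := FreeAlgebra.ι ℂ 1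

/-- The two-sided ideal of Grassmann relations `x², y², xy + yx`. -/
def grassmannIdeal : TwoSidedIdeal F2 :=
  TwoSidedIdeal.span {xg * xg, yg * yg, xg * yg + yg * xg}

/-- `L A B` is the matrix of linear forms whose `(i,j)` entry is `A i j • x + B i j • y`. -/
def L (A B : Matrix (Fin 2) (Fin 2) ℂ) : Matrix (Fin 2) (Fin 2) F2 :=
  fun i j => A i j • xg + B i j • yg

lemma L_mul_apply (A B C D : Matrix (Fin 2) (Fin 2) ℂ) (i j : Fin 2) :
    (L A B * L C D) i j = (A * C) i j • (xg * xg) + (A * D) i j • (xg * yg)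
      + (B * C) i j • (yg * xg) + (B * D) i j • (yg * yg) := by
  simp only [Matrix.mul_apply, Fin.sum_univ_two, L, add_mul, mul_add, smul_mul_assoc,
    mul_smul_comm]
  module

lemma smul_mem_gr (c : ℂ) {f : F2} (h : f ∈ grassmannIdeal) : c • f ∈ grassmannIdeal := by
  rw [Algebra.smul_def]
  exact grassmannIdeal.mul_mem_left _ _ h

def repX : Matrix (Fin 4) (Fin 4) ℂ := !![0,0,0,0; 1,0,0,0; 0,0,0,0; 0,0,1,0]
def repY : Matrix (Fin 4) (Fin 4) ℂ := !![0,0,0,0; 0,0,0,0; 1,0,0,0; 0,-1,0,0]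

def rep : F2 →ₐ[ℂ] Matrix (Fin 4) (Fin 4) ℂ := FreeAlgebra.lift ℂ ![repX, repY]

lemma rep_x : rep xg = repX := by simp [rep, xg]
lemma rep_y : rep yg = repY := by simp [rep, yg]

lemma XX : repX * repX = 0 := by
  ext i j; fin_cases i <;> fin_cases j <;> simp [repX, Matrix.mul_apply, Fin.sum_univ_four]
lemma YY : repY * repY = 0 := by
  ext i j; fin_cases i <;> fin_cases j <;> simp [repY, Matrix.mul_apply, Fin.sum_univ_four]
lemma XY : repX * repY = Matrix.single 3 0 1 := by
  ext i j; fin_cases i <;> fin_cases j <;> simp [repX, repY, Matrix.mul_apply, Fin.sum_univ_four, Matrix.single]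
lemma YX : repY * repX = -Matrix.single 3 0 1 := by
  ext i j; fin_cases i <;> fin_cases j <;> simp [repX, repY, Matrix.mul_apply, Fin.sum_univ_four, Matrix.single]

lemma rep_zero {f : F2} (h : f ∈ grassmannIdeal) : rep f = 0 := by
  have : grassmannIdeal ≤ TwoSidedIdeal.ker rep := by
    rw [grassmannIdeal, TwoSidedIdeal.span_le]
    rintro f (rfl | rfl | rfl) <;> 
      simp [TwoSidedIdeal.mem_ker, rep_x, rep_y, XX, YY, XY, YX]
  exact (TwoSidedIdeal.mem_ker _).1 (this h)

lemma gens_mem : xg * xg ∈ grassmannIdeal ∧ yg * yg ∈ grassmannIdeal ∧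
    xg * yg + yg * xg ∈ grassmannIdeal := by
  refine ⟨?_, ?_, ?_⟩ <;> exact TwoSidedIdeal.subset_span (by simp)

lemma quad_mem (a b c d : ℂ) : a • (xg * xg) + b • (xg * yg) + c • (yg * xg) + d • (yg * yg)
    ∈ grassmannIdeal ↔ b = c := by
  constructor
  · intro h
    have h1 := congrFun (congrFun (rep_zero h) 3) 0
    simp [rep_x, rep_y, XX, YY, XY, YX] at h1
    linear_combination h1
  · rintro rfl
    have := grassmannIdeal.add_mem (grassmannIdeal.add_mem (smul_mem_gr a gens_mem.1)
      (smul_mem_gr b gens_mem.2.2)) (smul_mem_gr d gens_mem.2.1)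
    rwa [smul_add, ← add_assoc] at this

/-- `T` is the unique `ℂ`-algebra homomorphism `F → M₂(F)` with `T x = L A B` and
`T y = L C D`. It maps the Grassmann ideal `I` into `M₂(I)` iff
`A·B = B·A`, `C·D = D·C` and `A·D − D·A = B·C − C·B`. -/
theorem grassmann_T_consistent_iff (A B C D : Matrix (Fin 2) (Fin 2) ℂ) :
    (∀ f ∈ grassmannIdeal, ∀ i j,
        (FreeAlgebra.lift ℂ ![L A B, L C D] : F2 →ₐ[ℂ] Matrix (Fin 2) (Fin 2) F2)
          f i j ∈ grassmannIdeal) ↔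
      A * B = B * A ∧ C * D = D * C ∧ A * D - D * A = B * C - C * B := by
  set T : F2 →ₐ[ℂ] Matrix (Fin 2) (Fin 2) F2 := FreeAlgebra.lift ℂ ![L A B, L C D] with hT
  have Tx : T xg = L A B := by simp [hT, xg]
  have Ty : T yg = L C D := by simp [hT, yg]
  have hxx : (∀ i j, T (xg * xg) i j ∈ grassmannIdeal) ↔ A * B = B * A := by
    simp only [map_mul, Tx, L_mul_apply, quad_mem, ← Matrix.ext_iff]
  have hyy : (∀ i j, T (yg * yg) i j ∈ grassmannIdeal) ↔ C * D = D * C := by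
    simp only [map_mul, Ty, L_mul_apply, quad_mem, ← Matrix.ext_iff]
  have hxy : (∀ i j, T (xg * yg + yg * xg) i j ∈ grassmannIdeal) ↔
      A * D - D * A = B * C - C * B := by
    rw [← Matrix.ext_iff]
    refine forall_congr' fun i => forall_congr' fun j => ?_
    have e : T (xg * yg + yg * xg) i j = ((A * C) i j + (C * A) i j) • (xg * xg)
        + ((A * D) i j + (C * B) i j) • (xg * yg) + ((B * C) i j + (D * A) i j) • (yg * xg)
        + ((B * D) i j + (D * B) i j) • (yg * yg) := by
      simp only [map_add, map_mul, Tx, Ty, Matrix.add_apply, L_mul_apply, add_smul]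
      abel
    rw [e, quad_mem, Matrix.sub_apply, Matrix.sub_apply]
    constructor <;> intro h <;> linear_combination h
  rw [← hxx, ← hyy, ← hxy]
  constructor
  · intro h
    exact ⟨h _ gens_mem.1, h _ gens_mem.2.1, h _ gens_mem.2.2⟩
  · rintro ⟨h1, h2, h3⟩ f hf
    have key : grassmannIdeal ≤ (grassmannIdeal.matrix (Fin 2)).comap T := by
      conv_lhs => rw [grassmannIdeal]
      rw [TwoSidedIdeal.span_le]
      rintro g (rfl | rfl | rfl)
      · simpa [TwoSidedIdeal.mem_comap, TwoSidedIdeal.mem_matrix] using h1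
      · simpa [TwoSidedIdeal.mem_comap, TwoSidedIdeal.mem_matrix] using h2
      · simpa [TwoSidedIdeal.mem_comap, TwoSidedIdeal.mem_matrix] using h3
    have := key hf
    rw [TwoSidedIdeal.mem_comap, TwoSidedIdeal.mem_matrix] at this
    exact this
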